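/- arXiv:0710.3267 — 2 statements merged into one kernel-verified Lean document; each statement's English description precedes it below -/
import Mathlib

section
/- The uniform spread of the alternating group A₇ is less than four: for every element s ∈ A₇ there exist nonidentity elements x₁, x₂, x₃, x₄ ∈ A₇ such that for every h ∈ A₇ there is some i ∈ {1,2,3,4} with ⟨x_i, h⁻¹sh⟩ ≠ A₇ (i.e., no conjugate of s generates A₇ together with each of x₁, x₂, x₃, x₄). -/
/-- `A₇` viewed as a group in its own right. -/
abbrev A7 : Type := alternatingGroup (Fin 7)

/-- Octal digit number `i` of `T`. -/
def lk (T i : ℕ) : ℕ := Nat.mod (Nat.div T (Nat.pow 8 i)) 8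

/-- Enumerate the tables of derangements, packed in octal, and apply a test to each. -/
def en (chk : ℕ → Bool) : ℕ → List ℕ → ℕ → Bool
  | 0, _, T => chk T
  | n + 1, rem, T =>
    rem.all fun a => Nat.beq a n || en chk n (rem.erase a) (Nat.add (Nat.mul 8 T) a)

/-- Packing of a table. -/
def pk (t : ℕ → ℕ) : ℕ → ℕ → ℕ
  | 0, T => T
  | n + 1, T => pk t n (8 * T + t n)

theorem en_sound (chk : ℕ → Bool) (t : ℕ → ℕ) (n : ℕ) : ∀ (rem : List ℕ) (T : ℕ),
    en chk n rem T = true → (∀ i < n, t i ∈ rem) → (∀ i < n, t i ≠ i) →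
    (∀ i < n, ∀ j < n, t i = t j → i = j) → chk (pk t n T) = true := by
  induction n with
  | zero => intro rem T h _ _ _; exact h
  | succ n ih =>
    intro rem T h h1 h2 h3
    rw [en, List.all_eq_true] at h
    have h4 := h (t n) (h1 n (by omega))
    have h5 : Nat.beq (t n) n = false := by
      rw [Bool.eq_false_iff]
      intro h; exact h2 n (by omega) (Nat.eq_of_beq_eq_true h)
    rw [h5, Bool.false_or] at h4
    refine ih _ _ h4 (fun i hi => ?_) (fun i hi => h2 i (by omega))
      (fun i hi j hj => h3 i (by omega) j (by omega))
    refine (List.mem_erase_of_ne ?_).2 (h1 i (by omega))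
    intro h
    have := h3 i (by omega) n (by omega) h
    omega

theorem lk_pk (t : ℕ → ℕ) (ht : ∀ i < 7, t i < 8) (i : ℕ) (hi : i < 7) :
    lk (pk t 7 0) i = t i := by
  have h0 := ht 0 (by norm_num)
  have h1 := ht 1 (by norm_num)
  have h2 := ht 2 (by norm_num)
  have h3 := ht 3 (by norm_num)
  have h4 := ht 4 (by norm_num)
  have h5 := ht 5 (by norm_num)
  have h6 := ht 6 (by norm_num)
  change (pk t 7 0) / 8 ^ i % 8 = t i
  simp only [pk]
  interval_cases i <;> norm_num <;> omega

/-- The pairs of points in increasing order. -/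
def prs : List (ℕ × ℕ) :=
  [(0, 1), (0, 2), (0, 3), (0, 4), (0, 5), (0, 6), (1, 2), (1, 3), (1, 4), (1, 5), (1, 6),
   (2, 3), (2, 4), (2, 5), (2, 6), (3, 4), (3, 5), (3, 6), (4, 5), (4, 6), (5, 6)]

/-- Parity of the number of inversions: `true` for odd tables. -/
def oddT (T : ℕ) : Bool := prs.foldr (fun p b => xor (Nat.ble (lk T p.2) (lk T p.1)) b) false

/-- The points. -/
def pts : List ℕ := [0, 1, 2, 3, 4, 5, 6]

/-- The sixth power is trivial. -/
def pow6T (T : ℕ) : Bool :=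
  pts.all fun i => Nat.beq (lk T (lk T (lk T (lk T (lk T (lk T i)))))) i

/-- The seventh power is trivial. -/
def pow7T (T : ℕ) : Bool :=
  pts.all fun i => Nat.beq (lk T (lk T (lk T (lk T (lk T (lk T (lk T i))))))) i

/-- Membership in the set of the first three points of the orbit of `a`. -/
def orbT (T a i : ℕ) : Bool := Nat.beq i a || Nat.beq i (lk T a) || Nat.beq i (lk T (lk T a))

/-- `X` and `T` preserve the first three points of some orbit of `T`. -/
def invOrbT (X T : ℕ) : Bool :=
  pts.any fun a => pts.all fun i =>
    (orbT T a (lk X i) == orbT T a i) && (orbT T a (lk T i) == orbT T a i)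

/-- Sum to zero in the Fano plane of nonzero vectors. -/
def colT (u v w : ℕ) : Bool := Nat.beq (Nat.xor u (Nat.xor v w)) 0

/-- `T` maps lines of the plane labelled by `p` to lines. -/
def invColT (T : ℕ) (p : ℕ × ℕ) : Bool :=
  let q : ℕ → ℕ := fun u => lk p.1 (lk T (lk p.2 u))
  colT (q 1) (q 2) (q 3) && colT (q 1) (q 4) (q 5) && colT (q 1) (q 6) (q 7) &&
    colT (q 2) (q 4) (q 6) && colT (q 2) (q 5) (q 7) && colT (q 3) (q 4) (q 7) &&
    colT (q 3) (q 5) (q 6)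

/-- Packed labellings (and inverses) of the Fano planes preserved by `(0 1)(2 3)`. -/
def planes3 : List (ℕ × ℕ) :=
  [(1752849, 8038464), (1523473, 7809088), (1695505, 8006208),
   (1007377, 7744576), (1437457, 7547456), (978705, 7515200)]

/-- Packed labellings (and inverses) of the Fano planes preserved by `(0 1)(2 4)`. -/
def planes4 : List (ℕ × ℕ) :=
  [(1767185, 10135104), (1537809, 9905728), (1702673, 10070592),
   (1014545, 9808960), (1441041, 9382464), (982289, 9350208)]

/-- Packed labellings (and inverses) of the Fano planes preserved by `(0 1)(2 5)`. -/
def planes5 : List (ℕ × ℕ) :=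
  [(1824529, 12199488), (1566481, 11740736), (1817361, 12167232),
   (1043217, 11643968), (1555729, 11479104), (1039633, 11414592)]

/-- Packed labellings (and inverses) of the Fano planes preserved by `(0 1)(2 6)`. -/
def planes6 : List (ℕ × ℕ) :=
  [(2053905, 14034496), (2025233, 13805120), (2046737, 14002240),
   (1960721, 13740608), (2014481, 13543488), (1957137, 13511232)]

/-- The complete test of a derangement. -/
def testT (T : ℕ) : Bool :=
  (pow7T T && (planes3.any (invColT T) || planes4.any (invColT T) ||
    planes5.any (invColT T) || planes6.any (invColT T))) ||
  (pow6T T && (invOrbT 1754641 T || invOrbT 1753241 T || invOrbT 1753290 T)) ||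
  oddT T

set_option maxRecDepth 100000 in
set_option maxHeartbeats 0 in
theorem test_all : en testT 7 [0, 1, 2, 3, 4, 5, 6] 0 = true := by
  decide +kernel

/-- Packed table of a permutation. -/
def tbl (t : Equiv.Perm (Fin 7)) : ℕ :=
  pk (fun i => if h : i < 7 then (t ⟨i, h⟩).val else 0) 7 0

theorem lk_tbl (t : Equiv.Perm (Fin 7)) (i : Fin 7) : lk (tbl t) i.val = (t i).val := by
  unfold tbl
  rw [lk_pk _ _ _ i.isLt]
  · simp
  · intro i hi
    simp only [hi, dif_pos]
    omega

theorem testT_tbl (t : Equiv.Perm (Fin 7)) (ht : ∀ i, t i ≠ i) : testT (tbl t) = true := by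
  unfold tbl
  refine en_sound testT _ 7 _ 0 test_all ?_ ?_ ?_
  · intro i hi
    simp only [hi, dif_pos]
    generalize t ⟨i, hi⟩ = a
    revert a; decide
  · intro i hi
    simp only [hi, dif_pos]
    intro h
    exact ht ⟨i, hi⟩ (Fin.ext h)
  · intro i hi j hj
    simp only [hi, hj, dif_pos]
    intro h
    simpa using t.injective (Fin.ext h)

/-- The pairs of points, as a list in `Fin 7`. -/
def prsF : List (Σ _ : Fin 7, Fin 7) :=
  [⟨1, 0⟩, ⟨2, 0⟩, ⟨3, 0⟩, ⟨4, 0⟩, ⟨5, 0⟩, ⟨6, 0⟩, ⟨2, 1⟩, ⟨3, 1⟩, ⟨4, 1⟩, ⟨5, 1⟩, ⟨6, 1⟩,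
   ⟨3, 2⟩, ⟨4, 2⟩, ⟨5, 2⟩, ⟨6, 2⟩, ⟨4, 3⟩, ⟨5, 3⟩, ⟨6, 3⟩, ⟨5, 4⟩, ⟨6, 4⟩, ⟨6, 5⟩]

theorem sign_fold (t : Equiv.Perm (Fin 7)) (l : List (Σ _ : Fin 7, Fin 7))
    (hl : ∀ p ∈ l, p.2 < p.1) :
    (l.map fun p => if t p.2 < t p.1 then (1 : ℤˣ) else -1).prod =
      if (l.map fun p => (p.2.val, p.1.val)).foldr
        (fun p b => xor (Nat.ble (lk (tbl t) p.2) (lk (tbl t) p.1)) b) false = true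
      then -1 else 1 := by
  induction l with
  | nil => simp
  | cons p l ih =>
    have ih := ih fun q hq => hl q (List.mem_cons_of_mem _ hq)
    rw [List.map_cons, List.prod_cons, ih, List.map_cons, List.foldr_cons]
    simp only [lk_tbl]
    have hne : t p.2 ≠ t p.1 := fun h => (hl p (List.mem_cons_self)).ne (t.injective h)
    generalize List.foldr _ _ _ = b
    by_cases h : t p.2 < t p.1
    · have : Nat.ble (t p.1).val (t p.2).val = false := by
        rw [Bool.eq_false_iff]; intro h'
        have := Nat.le_of_ble_eq_true h'
        omega
      simp [h, this]
    · have : Nat.ble (t p.1).val (t p.2).val = true := by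
        apply Nat.ble_eq_true_of_le
        omega
      cases b <;> simp [h, this]

theorem not_oddT (t : Equiv.Perm (Fin 7)) (ht : Equiv.Perm.sign t = 1) : oddT (tbl t) = false := by
  rw [Equiv.Perm.sign_eq_prod_prod_Iio, Finset.prod_sigma'] at ht
  have h1 : (Finset.univ.sigma fun j : Fin 7 => Finset.Iio j) = prsF.toFinset := by decide +kernel
  rw [h1, List.prod_toFinset _ (by decide +kernel), sign_fold t _ (by decide +kernel)] at ht
  have h2 : prsF.map (fun p => (p.2.val, p.1.val)) = prs := by decide +kernel
  rw [h2] at ht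
  change (if oddT (tbl t) = true then (-1 : ℤˣ) else 1) = 1 at ht
  cases h : oddT (tbl t)
  · rfl
  · rw [h] at ht
    exact absurd ht (by decide)

theorem mem_pts (i : Fin 7) : i.val ∈ pts := by revert i; decide

theorem pow6_of (t : Equiv.Perm (Fin 7)) (h : pow6T (tbl t) = true) : t ^ 6 = 1 := by
  ext i
  have := Nat.eq_of_beq_eq_true (List.all_eq_true.1 h i.val (mem_pts i))
  simp only [lk_tbl] at this
  exact this

theorem pow7_of (t : Equiv.Perm (Fin 7)) (h : pow7T (tbl t) = true) : t ^ 7 = 1 := by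
  ext i
  have := Nat.eq_of_beq_eq_true (List.all_eq_true.1 h i.val (mem_pts i))
  simp only [lk_tbl] at this
  exact this

theorem closure_ne_top (K : Subgroup (Equiv.Perm (Fin 7))) (x t y : A7)
    (hx : (x : Equiv.Perm (Fin 7)) ∈ K) (ht : (t : Equiv.Perm (Fin 7)) ∈ K)
    (hy : (y : Equiv.Perm (Fin 7)) ∉ K) : Subgroup.closure {x, t} ≠ ⊤ := by
  intro h
  have h1 : Subgroup.closure {x, t} ≤ K.comap (alternatingGroup (Fin 7)).subtype := by
    rw [Subgroup.closure_le]
    rintro z (rfl | rfl)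
    · exact hx
    · exact ht
  rw [h] at h1
  exact hy (h1 (Subgroup.mem_top y))

/-- The stabilizer of a set of points. -/
def setStab (R : Fin 7 → Bool) : Subgroup (Equiv.Perm (Fin 7)) where
  carrier := {g | ∀ i, R (g i) = R i}
  one_mem' _ := rfl
  mul_mem' {a b} ha hb i := (ha (b i)).trans (hb i)
  inv_mem' {a} ha i := by simpa using (ha (a⁻¹ i)).symm

/-- The three-cycle `(a b c)`. -/
def tri (a b c : Fin 7) (h : Equiv.Perm.sign (Equiv.swap a b * Equiv.swap b c) = 1) : A7 :=
  ⟨Equiv.swap a b * Equiv.swap b c, h⟩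

/-- The involution `(0 1)(2 k)`. -/
def dbl (k : Fin 7) (h : Equiv.Perm.sign (Equiv.swap 0 1 * Equiv.swap 2 k) = 1) : A7 :=
  ⟨Equiv.swap 0 1 * Equiv.swap 2 k, h⟩

theorem exists_not_mem_setStab (R : Fin 7 → Bool) (a b : Fin 7) (ha : R a = true)
    (hb : R b = false) : ∃ y : A7, (y : Equiv.Perm (Fin 7)) ∉ setStab R := by
  by_contra! H
  have h1 := H (tri 0 1 2 (by decide))
  have h2 := H (tri 2 3 4 (by decide))
  have h3 := H (tri 4 5 6 (by decide))
  have e1 : R 1 = R 0 := h1 0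
  have e2 : R 2 = R 1 := h1 1
  have e3 : R 3 = R 2 := h2 2
  have e4 : R 4 = R 3 := h2 3
  have e5 : R 5 = R 4 := h3 4
  have e6 : R 6 = R 5 := h3 5
  have key : ∀ i, R i = R 0 := by
    intro i
    fin_cases i <;> simp [e1, e2, e3, e4, e5, e6]
  rw [key] at ha hb
  rw [ha] at hb
  cases hb

theorem ne_top_of_fixed (x t : A7) (a : Fin 7) (hx : (x : Equiv.Perm (Fin 7)) a = a)
    (ht : (t : Equiv.Perm (Fin 7)) a = a) : Subgroup.closure {x, t} ≠ ⊤ := by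
  have hb : ∃ b : Fin 7, b ≠ a := ⟨a + 1, by clear hx ht; revert a; decide⟩
  obtain ⟨b, hb⟩ := hb
  obtain ⟨y, hy⟩ := exists_not_mem_setStab (fun i => decide (i = a)) a b (by simp) (by simp [hb])
  refine closure_ne_top _ x t y ?_ ?_ hy
  · intro i
    have : (x : Equiv.Perm (Fin 7)) i = a ↔ i = a :=
      ⟨fun h => x.1.injective (h.trans hx.symm), fun h => by rw [h, hx]⟩
    simp only [this]
  · intro i
    have : (t : Equiv.Perm (Fin 7)) i = a ↔ i = a :=
      ⟨fun h => t.1.injective (h.trans ht.symm), fun h => by rw [h, ht]⟩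
    simp only [this]

theorem ne_top_of_orb (x t : A7) (X : ℕ) (hX : tbl x = X) (h : invOrbT X (tbl t) = true) :
    Subgroup.closure {x, t} ≠ ⊤ := by
  subst hX
  obtain ⟨a', ha', h⟩ := List.any_eq_true.1 h
  obtain ⟨a, rfl⟩ : ∃ a : Fin 7, a.val = a' := by
    simp only [pts, List.mem_cons, List.not_mem_nil, or_false] at ha'
    exact ⟨⟨a', by omega⟩, rfl⟩
  rw [List.all_eq_true] at h
  have hR : ∀ i : Fin 7, orbT (tbl t) a i = true ↔
      i = a ∨ i = t.1 a ∨ i = t.1 (t.1 a) := by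
    intro i
    have e : ∀ u v : Fin 7, Nat.beq u.val v.val = true ↔ u = v := fun u v => by
      rw [Nat.beq_eq, Fin.ext_iff]
    simp only [orbT, lk_tbl, Bool.or_eq_true, e, or_assoc]
  obtain ⟨b, hb⟩ : ∃ b, ¬ (b = a ∨ b = t.1 a ∨ b = t.1 (t.1 a)) := by
    have : ∀ u v w : Fin 7, ∃ b, ¬ (b = u ∨ b = v ∨ b = w) := by decide
    exact this _ _ _
  obtain ⟨y, hy⟩ := exists_not_mem_setStab (fun i => orbT (tbl t) a i) a b
    ((hR a).2 (Or.inl rfl)) (by rw [Bool.eq_false_iff]; exact fun h => hb ((hR b).1 h))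
  refine closure_ne_top _ x t y ?_ ?_ hy
  · intro i
    have := h i.val (mem_pts i)
    simp only [lk_tbl, Bool.and_eq_true, beq_iff_eq] at this
    exact this.1
  · intro i
    have := h i.val (mem_pts i)
    simp only [lk_tbl, Bool.and_eq_true, beq_iff_eq] at this
    exact this.2

/-- Permutations that send lines of a labelled plane to lines. -/
def lineStab (f : ℕ) : Subgroup (Equiv.Perm (Fin 7)) :=
  let M : Submonoid (Equiv.Perm (Fin 7)) :=
    { carrier := {g | ∀ i j k : Fin 7, colT (lk f i) (lk f j) (lk f k) = true →
        colT (lk f (g i)) (lk f (g j)) (lk f (g k)) = true}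
      one_mem' := fun _ _ _ h => h
      mul_mem' := fun {_ b} ha hb i j k h => ha (b i) (b j) (b k) (hb i j k h) }
  { M with
    inv_mem' := fun {a} ha => by
      have h1 : a⁻¹ = a ^ (orderOf a - 1) := by
        refine inv_eq_of_mul_eq_one_left ?_
        rw [← pow_succ, Nat.sub_add_cancel (orderOf_pos a), pow_orderOf_eq_one]
      have h2 : a ∈ M := ha
      have h3 : a⁻¹ ∈ M := by
        rw [h1]
        exact pow_mem h2 _
      exact h3 }

theorem colT_iff (u v w : ℕ) : colT u v w = true ↔ u ^^^ (v ^^^ w) = 0 := by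
  unfold colT
  rw [Nat.beq_eq]
  rfl

theorem colT_swap (u v w : ℕ) : colT u v w = colT v u w := by
  rw [Bool.eq_iff_iff, colT_iff, colT_iff, ← Nat.xor_assoc, Nat.xor_comm u v, Nat.xor_assoc]

theorem colT_swap' (u v w : ℕ) : colT u v w = colT u w v := by
  rw [Bool.eq_iff_iff, colT_iff, colT_iff, Nat.xor_comm v w]

/-- A labelling is good if it is a bijection onto the nonzero vectors and the three-cycle
`(0 1 2)` is not a collineation. -/
def Good (p : ℕ × ℕ) : Prop :=
  (∀ i : Fin 7, lk p.2 (lk p.1 i) = i.val ∧ lk p.1 i ≠ 0) ∧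
  ∃ i j k : Fin 7, colT (lk p.1 i) (lk p.1 j) (lk p.1 k) = true ∧
    colT (lk p.1 ((tri 0 1 2 (by decide)).1 i)) (lk p.1 ((tri 0 1 2 (by decide)).1 j))
      (lk p.1 ((tri 0 1 2 (by decide)).1 k)) = false

instance (p : ℕ × ℕ) : Decidable (Good p) := inferInstanceAs (Decidable (_ ∧ _))

theorem std_lines : ∀ u v w : Fin 8, u ≠ 0 → v ≠ 0 → w ≠ 0 →
    colT u.val v.val w.val = true →
    ∃ l ∈ [((1 : ℕ), (2 : ℕ), (3 : ℕ)), (1, 4, 5), (1, 6, 7), (2, 4, 6), (2, 5, 7), (3, 4, 7),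
      (3, 5, 6)],
      (u.val, v.val, w.val) ∈ [(l.1, l.2.1, l.2.2), (l.1, l.2.2, l.2.1), (l.2.1, l.1, l.2.2),
        (l.2.1, l.2.2, l.1), (l.2.2, l.1, l.2.1), (l.2.2, l.2.1, l.1)] := by
  decide +kernel

theorem mem_lineStab (t : Equiv.Perm (Fin 7)) (p : ℕ × ℕ) (hp : Good p)
    (h : invColT (tbl t) p = true) : t ∈ lineStab p.1 := by
  intro i j k hc
  have hq : ∀ i : Fin 7, lk p.1 (lk (tbl t) (lk p.2 (lk p.1 i))) = lk p.1 (t i) := fun i => by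
    rw [(hp.1 i).1, lk_tbl]
  rw [← hq i, ← hq j, ← hq k]
  have hlt : ∀ i : Fin 7, lk p.1 i < 8 := fun i => Nat.mod_lt _ (by norm_num)
  have hs := std_lines ⟨_, hlt i⟩ ⟨_, hlt j⟩ ⟨_, hlt k⟩
    (fun h => (hp.1 i).2 (congrArg Fin.val h)) (fun h => (hp.1 j).2 (congrArg Fin.val h))
    (fun h => (hp.1 k).2 (congrArg Fin.val h)) hc
  simp only at hs
  obtain ⟨l, hl, hs⟩ := hs
  generalize lk p.1 i = u at hs ⊢
  generalize lk p.1 j = v at hs ⊢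
  generalize lk p.1 k = w at hs ⊢
  unfold invColT at h
  set q : ℕ → ℕ := fun u => lk p.1 (lk (tbl t) (lk p.2 u)) with hqdef
  change colT (q u) (q v) (q w) = true
  have hl' : colT (q l.1) (q l.2.1) (q l.2.2) = true := by
    simp only [Bool.and_eq_true] at h
    simp only [List.mem_cons, List.not_mem_nil, or_false] at hl
    rcases hl with rfl | rfl | rfl | rfl | rfl | rfl | rfl <;> simp only [h]
  clear_value q
  simp only [List.mem_cons, List.not_mem_nil, or_false, Prod.mk.injEq] at hs
  rcases hs with ⟨rfl, rfl, rfl⟩ | ⟨rfl, rfl, rfl⟩ | ⟨rfl, rfl, rfl⟩ | ⟨rfl, rfl, rfl⟩ |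
    ⟨rfl, rfl, rfl⟩ | ⟨rfl, rfl, rfl⟩
  · exact hl'
  · rw [colT_swap']; exact hl'
  · rw [colT_swap]; exact hl'
  · rw [colT_swap', colT_swap]; exact hl'
  · rw [colT_swap, colT_swap']; exact hl'
  · rw [colT_swap, colT_swap', colT_swap]; exact hl'

theorem ne_top_of_planes (L : List (ℕ × ℕ)) (x t : A7)
    (hL : ∀ p ∈ L, Good p ∧ invColT (tbl x) p = true) (h : L.any (invColT (tbl t)) = true) :
    Subgroup.closure {x, t} ≠ ⊤ := by
  obtain ⟨p, hp, h⟩ := List.any_eq_true.1 h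
  obtain ⟨hg, hx⟩ := hL p hp
  refine closure_ne_top (lineStab p.1) x t (tri 0 1 2 (by decide)) (mem_lineStab _ p hg hx)
    (mem_lineStab _ p hg h) ?_
  intro hm
  obtain ⟨i, j, k, h1, h2⟩ := hg.2
  have := hm i j k h1
  rw [h2] at this
  cases this

theorem good3 : ∀ p ∈ planes3, Good p ∧ invColT (tbl (dbl 3 (by decide))) p = true := by
  decide +kernel

theorem good4 : ∀ p ∈ planes4, Good p ∧ invColT (tbl (dbl 4 (by decide))) p = true := by
  decide +kernel

theorem good5 : ∀ p ∈ planes5, Good p ∧ invColT (tbl (dbl 5 (by decide))) p = true := by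
  decide +kernel

theorem good6 : ∀ p ∈ planes6, Good p ∧ invColT (tbl (dbl 6 (by decide))) p = true := by
  decide +kernel

/-- `A₇` has uniform spread less than four. -/
theorem stmt_16 :
    ∀ s : A7, ∃ x₁ x₂ x₃ x₄ : A7,
      x₁ ≠ 1 ∧ x₂ ≠ 1 ∧ x₃ ≠ 1 ∧ x₄ ≠ 1 ∧
      ∀ h : A7,
        Subgroup.closure {x₁, h⁻¹ * s * h} ≠ ⊤ ∨
        Subgroup.closure {x₂, h⁻¹ * s * h} ≠ ⊤ ∨
        Subgroup.closure {x₃, h⁻¹ * s * h} ≠ ⊤ ∨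
        Subgroup.closure {x₄, h⁻¹ * s * h} ≠ ⊤ := by
  intro s
  have hpow : ∀ (h : A7) (n : ℕ), (h⁻¹ * s * h) ^ n = 1 ↔ s ^ n = 1 := by
    intro h n
    have e : (h⁻¹ * s * h) ^ n = h⁻¹ * s ^ n * h := by
      have := conj_pow (i := n) (a := h⁻¹) (b := s)
      rwa [inv_inv] at this
    rw [e]
    constructor
    · intro h1
      have : s ^ n = h * (h⁻¹ * s ^ n * h) * h⁻¹ := by group
      rw [this, h1]; group
    · intro h1
      rw [h1]; group
  have hfix : ∀ (h : A7), (∃ i, (h⁻¹ * s * h).1 i = i) → ∃ i, s.1 i = i := by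
    rintro h ⟨i, hi⟩
    refine ⟨h.1 i, ?_⟩
    have : h.1⁻¹ (s.1 (h.1 i)) = i := hi
    rwa [Equiv.Perm.inv_eq_iff_eq] at this
  by_cases hA : (∃ i, s.1 i = i) ∨ s ^ 6 = 1
  · refine ⟨tri 0 1 2 (by decide), tri 0 1 3 (by decide), tri 0 2 3 (by decide),
      tri 4 5 6 (by decide), by decide +kernel, by decide +kernel, by decide +kernel,
      by decide +kernel, fun h => ?_⟩
    have hA' : (∃ i, (h⁻¹ * s * h).1 i = i) ∨ (h⁻¹ * s * h) ^ 6 = 1 := by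
      rcases hA with ⟨i, hi⟩ | hA
      · refine Or.inl ⟨h.1⁻¹ i, ?_⟩
        change h.1⁻¹ (s.1 (h.1 (h.1⁻¹ i))) = h.1⁻¹ i
        rw [← Equiv.Perm.mul_apply h.1, mul_inv_cancel, Equiv.Perm.one_apply, hi]
      · exact Or.inr ((hpow h 6).2 hA)
    generalize h⁻¹ * s * h = t at hA' ⊢
    by_cases hf : ∃ i, t.1 i = i
    · obtain ⟨a, ha⟩ := hf
      have : ∀ a : Fin 7, (tri 0 1 2 (by decide)).1 a = a ∨ (tri 0 1 3 (by decide)).1 a = a ∨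
          (tri 0 2 3 (by decide)).1 a = a ∨ (tri 4 5 6 (by decide)).1 a = a := by decide +kernel
      rcases this a with h | h | h | h
      · exact Or.inl (ne_top_of_fixed _ t a h ha)
      · exact Or.inr (Or.inl (ne_top_of_fixed _ t a h ha))
      · exact Or.inr (Or.inr (Or.inl (ne_top_of_fixed _ t a h ha)))
      · exact Or.inr (Or.inr (Or.inr (ne_top_of_fixed _ t a h ha)))
    · have h6 := hA'.resolve_left hf
      push Not at hf
      have hT := testT_tbl t.1 hf
      have ho := not_oddT t.1 t.2
      have h7 : pow7T (tbl t.1) = false := by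
        rw [Bool.eq_false_iff]
        intro h7
        have h7 := pow7_of _ h7
        have h6 : t.1 ^ 6 = 1 := congrArg Subtype.val h6
        rw [pow_succ, h6, one_mul] at h7
        exact hf 0 (by rw [h7]; rfl)
      simp only [testT, ho, h7, Bool.false_and, Bool.false_or, Bool.or_false, Bool.and_eq_true,
        Bool.or_eq_true] at hT
      rcases hT.2 with (h | h) | h
      · exact Or.inl (ne_top_of_orb _ t _ (by decide +kernel) h)
      · exact Or.inr (Or.inl (ne_top_of_orb _ t _ (by decide +kernel) h))
      · exact Or.inr (Or.inr (Or.inl (ne_top_of_orb _ t _ (by decide +kernel) h)))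
  · refine ⟨dbl 3 (by decide), dbl 4 (by decide), dbl 5 (by decide), dbl 6 (by decide),
      by decide +kernel, by decide +kernel, by decide +kernel, by decide +kernel, fun h => ?_⟩
    push Not at hA
    have hf : ∀ i, (h⁻¹ * s * h).1 i ≠ i := fun i hi => by
      obtain ⟨j, hj⟩ := hfix h ⟨i, hi⟩
      exact hA.1 j hj
    have h6 : (h⁻¹ * s * h) ^ 6 ≠ 1 := fun h6 => hA.2 ((hpow h 6).1 h6)
    generalize h⁻¹ * s * h = t at hf h6 ⊢
    have hT := testT_tbl t.1 hf
    have ho := not_oddT t.1 t.2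
    have h6 : pow6T (tbl t.1) = false := by
      rw [Bool.eq_false_iff]
      intro h'
      exact h6 (Subtype.ext (pow6_of _ h'))
    simp only [testT, ho, h6, Bool.false_and, Bool.or_false, Bool.and_eq_true,
      Bool.or_eq_true] at hT
    rcases hT.2 with ((h | h) | h) | h
    · exact Or.inl (ne_top_of_planes _ _ t good3 h)
    · exact Or.inr (Or.inl (ne_top_of_planes _ _ t good4 h))
    · exact Or.inr (Or.inr (Or.inl (ne_top_of_planes _ _ t good5 h)))
    · exact Or.inr (Or.inr (Or.inr (ne_top_of_planes _ _ t good6 h)))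
end

section
/- The uniform spread of the group L₃(2) = SL(3, 𝔽₂) is at least three, with s of order 7: for all nonidentity elements x₁, x₂, x₃ ∈ SL(3, 𝔽₂) there exists s ∈ SL(3, 𝔽₂) of order 7 such that ⟨x_i, s⟩ = SL(3, 𝔽₂) for each i ∈ {1, 2, 3}. -/
/-- `L₃(2) = SL(3, 𝔽₂)`. -/
abbrev L32 : Type := Matrix.SpecialLinearGroup (Fin 3) (ZMod 2)

/-- 3×3 matrices over the two-element field, in a form the kernel evaluates quickly. -/
structure BMat where
  (a b c d e f g h i : Bool)

namespace BMat

def mul (x y : BMat) : BMat :=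
  ⟨(x.a && y.a) ^^ (x.b && y.d) ^^ (x.c && y.g),
   (x.a && y.b) ^^ (x.b && y.e) ^^ (x.c && y.h),
   (x.a && y.c) ^^ (x.b && y.f) ^^ (x.c && y.i),
   (x.d && y.a) ^^ (x.e && y.d) ^^ (x.f && y.g),
   (x.d && y.b) ^^ (x.e && y.e) ^^ (x.f && y.h),
   (x.d && y.c) ^^ (x.e && y.f) ^^ (x.f && y.i),
   (x.g && y.a) ^^ (x.h && y.d) ^^ (x.i && y.g),
   (x.g && y.b) ^^ (x.h && y.e) ^^ (x.i && y.h),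
   (x.g && y.c) ^^ (x.h && y.f) ^^ (x.i && y.i)⟩

def det (x : BMat) : Bool :=
  (x.a && ((x.e && x.i) ^^ (x.f && x.h))) ^^ (x.b && ((x.d && x.i) ^^ (x.f && x.g))) ^^
    (x.c && ((x.d && x.h) ^^ (x.e && x.g)))

def beq (x y : BMat) : Bool :=
  (x.a == y.a) && (x.b == y.b) && (x.c == y.c) && (x.d == y.d) && (x.e == y.e) &&
  (x.f == y.f) && (x.g == y.g) && (x.h == y.h) && (x.i == y.i)

theorem eq_of_beq {x y : BMat} (h : beq x y = true) : x = y := by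
  cases x; cases y
  simpa [beq, and_assoc] using h

def one : BMat := ⟨true, false, false, false, true, false, false, false, true⟩

def s : BMat := ⟨false, false, true, true, false, true, false, true, false⟩

def r : BMat := ⟨false, false, true, false, true, false, true, true, true⟩

def t : Fin 3 → BMat
  | 0 => ⟨false, false, true, false, true, false, true, false, false⟩
  | 1 => ⟨false, false, true, false, true, false, true, false, true⟩
  | 2 => ⟨false, false, true, false, true, false, true, true, false⟩

def pow : Nat → BMat
  | 0 => one
  | n + 1 => mul s (pow n)

/-- Membership in the normalizer of the cyclic group generated by `s`. -/
def isN (x : BMat) : Bool :=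
  beq (mul x s) (mul s x) || beq (mul x s) (mul (mul s s) x) ||
    beq (mul x s) (mul (mul s (mul s (mul s s))) x)

def all (p : BMat → Bool) : Bool :=
  let q (k : Bool → Bool) : Bool := k true && k false
  q fun a => q fun b => q fun c => q fun d => q fun e => q fun f => q fun g => q fun h => q fun i =>
    p ⟨a, b, c, d, e, f, g, h, i⟩

theorem all_spec {p : BMat → Bool} (h : all p = true) (x : BMat) : p x = true := by
  obtain ⟨a, b, c, d, e, f, g, h', i⟩ := x
  simp only [all, Bool.and_eq_true] at h
  cases a <;> cases b <;> cases c <;> cases d <;> cases e <;> cases f <;> cases g <;>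
    cases h' <;> cases i <;> simp only [h]

/-- Search for a presentation `x = s ^ m * u * s ^ n`. -/
def inCoset (u x : BMat) : Bool :=
  (List.range 7).any fun m => (List.range 7).any fun n => beq x (mul (pow m) (mul u (pow n)))

def inU (x : BMat) : Bool :=
  (List.range 7).any fun m =>
    beq x (pow m) || beq x (mul (pow m) r) || beq x (mul (pow m) (mul r r))

def chk (x : BMat) : Bool :=
  cond (det x) (cond (isN x) (inU x) (inCoset (t 0) x || inCoset (t 1) x || inCoset (t 2) x)) true

theorem chk_all : all chk = true := by decide +kernel

/-- The conjugate of `x` by the `j`-th coset representative. -/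
def cj (j : Nat) (x : BMat) : BMat :=
  match j with
  | 0 => x
  | k + 1 => mul (t 0) (mul (pow (7 - k)) (mul x (mul (pow k) (t 0))))

def chk2 (x : BMat) : Bool :=
  cond (det x) (beq x one || Nat.ble ((List.range 8).countP fun j => isN (cj j x)) 2) true

theorem chk2_all : all chk2 = true := by decide +kernel

end BMat

section Transfer

def bz (b : Bool) : ZMod 2 := cond b 1 0

def zb (z : ZMod 2) : Bool := decide (z = 1)

theorem bz_zb (z : ZMod 2) : bz (zb z) = z := by revert z; decide

theorem bz_xor (x y : Bool) : bz (x ^^ y) = bz x + bz y := by revert x y; decide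

theorem bz_and (x y : Bool) : bz (x && y) = bz x * bz y := by revert x y; decide

def toMat (x : BMat) : Matrix (Fin 3) (Fin 3) (ZMod 2) :=
  !![bz x.a, bz x.b, bz x.c; bz x.d, bz x.e, bz x.f; bz x.g, bz x.h, bz x.i]

def ofMat (A : Matrix (Fin 3) (Fin 3) (ZMod 2)) : BMat :=
  ⟨zb (A 0 0), zb (A 0 1), zb (A 0 2), zb (A 1 0), zb (A 1 1), zb (A 1 2),
    zb (A 2 0), zb (A 2 1), zb (A 2 2)⟩

theorem zb_bz (b : Bool) : zb (bz b) = b := by revert b; decide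

theorem ofMat_toMat (x : BMat) : ofMat (toMat x) = x := by
  cases x; simp [ofMat, toMat, zb_bz]

theorem toMat_ofMat (A : Matrix (Fin 3) (Fin 3) (ZMod 2)) : toMat (ofMat A) = A := by
  ext i j
  fin_cases i <;> fin_cases j <;> simp [ofMat, toMat, bz_zb]

theorem toMat_mul (x y : BMat) : toMat (x.mul y) = toMat x * toMat y := by
  ext i j
  fin_cases i <;> fin_cases j <;>
    simp [toMat, BMat.mul, bz_xor, bz_and, Matrix.mul_apply, Fin.sum_univ_three, add_assoc]

theorem toMat_det (x : BMat) : (toMat x).det = bz x.det := by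
  simp only [toMat, BMat.det, Matrix.det_fin_three, Matrix.of_apply, Matrix.cons_val, bz_xor, bz_and, CharTwo.sub_eq_add]
  ring

theorem toMat_one : toMat BMat.one = 1 := by decide +kernel

def enc (x : L32) : BMat := ofMat x.1

theorem enc_inj {x y : L32} (h : enc x = enc y) : x = y := by
  apply Subtype.ext
  rw [← toMat_ofMat x.1, ← toMat_ofMat y.1]
  exact congrArg toMat h

theorem enc_mul (x y : L32) : enc (x * y) = (enc x).mul (enc y) := by
  rw [← ofMat_toMat ((enc x).mul (enc y)), toMat_mul]
  simp [enc, toMat_ofMat]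

theorem enc_one : enc 1 = BMat.one := by
  rw [← ofMat_toMat BMat.one, toMat_one]; rfl

theorem enc_det (x : L32) : (enc x).det = true := by
  have h := toMat_det (enc x)
  rw [enc, toMat_ofMat, x.2] at h
  have : ∀ b : Bool, (1 : ZMod 2) = bz b → b = true := by decide
  exact this _ h

/-- A determinant one Boolean matrix as a group element. -/
def el (x : BMat) (h : x.det = true) : L32 := ⟨toMat x, by rw [toMat_det, h]; rfl⟩

theorem enc_el (x : BMat) (h : x.det = true) : enc (el x h) = x := ofMat_toMat x

def S : L32 := el BMat.s (by decide)
def R : L32 := el BMat.r (by decide)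
def T (i : Fin 3) : L32 := el (BMat.t i) (by revert i; decide)

theorem enc_S : enc S = BMat.s := enc_el _ _
theorem enc_R : enc R = BMat.r := enc_el _ _
theorem enc_T (i : Fin 3) : enc (T i) = BMat.t i := enc_el _ _

theorem enc_pow (n : ℕ) : enc (S ^ n) = BMat.pow n := by
  induction n with
  | zero => rw [pow_zero]; exact enc_one
  | succ k ih => rw [pow_succ', enc_mul, ih, enc_S]; rfl

theorem S_pow : S ^ 7 = 1 := by
  apply enc_inj; rw [enc_pow, enc_one]; exact BMat.eq_of_beq (by decide)

theorem S_ne : S ≠ 1 := by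
  intro h
  have := congrArg (fun x => (enc x).a) h
  simp only [enc_S, enc_one] at this
  exact absurd this (by decide)

theorem T0_sq : T 0 * T 0 = 1 := by
  apply enc_inj; rw [enc_mul, enc_T, enc_one]; exact BMat.eq_of_beq (by decide)

theorem coset_spec {u : L32} {x : L32} (h : BMat.inCoset (enc u) (enc x) = true) :
    ∃ m n : ℕ, x = S ^ m * (u * S ^ n) := by
  simp only [BMat.inCoset, List.any_eq_true] at h
  obtain ⟨m, -, n, -, h⟩ := h
  refine ⟨m, n, enc_inj ?_⟩
  rw [enc_mul, enc_mul, enc_pow, enc_pow]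
  exact BMat.eq_of_beq h

theorem cover_T (x : L32) (h : BMat.isN (enc x) = false) :
    ∃ i, ∃ m n : ℕ, x = S ^ m * (T i * S ^ n) := by
  have h0 := BMat.all_spec BMat.chk_all (enc x)
  simp only [BMat.chk, enc_det, h, cond_true, cond_false, Bool.or_eq_true, ← enc_T] at h0
  rcases h0 with (h0 | h0) | h0
  exacts [⟨_, coset_spec h0⟩, ⟨_, coset_spec h0⟩, ⟨_, coset_spec h0⟩]

theorem cover_N (x : L32) (h : BMat.isN (enc x) = true) :
    ∃ m n : ℕ, x = S ^ m * R ^ n := by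
  have h0 := BMat.all_spec BMat.chk_all (enc x)
  simp only [BMat.chk, enc_det, h, cond_true, BMat.inU, List.any_eq_true, Bool.or_eq_true] at h0
  obtain ⟨m, -, (h0 | h0) | h0⟩ := h0
  · exact ⟨m, 0, enc_inj (by simpa [enc_pow] using BMat.eq_of_beq h0)⟩
  · exact ⟨m, 1, enc_inj (by simpa [enc_pow, enc_mul, enc_R] using BMat.eq_of_beq h0)⟩
  · exact ⟨m, 2, enc_inj (by simpa [enc_pow, enc_mul, enc_R, pow_two] using BMat.eq_of_beq h0)⟩

/-- A subgroup containing `S`, `R` and all `T i` is everything. -/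
theorem top_of_gens (H : Subgroup L32) (hS : S ∈ H) (hR : R ∈ H) (hT : ∀ i, T i ∈ H) : H = ⊤ := by
  rw [eq_top_iff]
  intro x _
  cases h : BMat.isN (enc x)
  · obtain ⟨i, m, n, rfl⟩ := cover_T x h
    exact H.mul_mem (H.pow_mem hS _) (H.mul_mem (hT i) (H.pow_mem hS _))
  · obtain ⟨m, n, rfl⟩ := cover_N x h
    exact H.mul_mem (H.pow_mem hS _) (H.pow_mem hR _)

/-- Words in `S` (for `true`) and a second element. -/
def word {α : Type} (mul : α → α → α) (e p q : α) : List Bool → α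
  | [] => e
  | b :: l => mul (cond b p q) (word mul e p q l)

theorem word_mem {H : Subgroup L32} {p q : L32} (hp : p ∈ H) (hq : q ∈ H) (l : List Bool) :
    word (· * ·) 1 p q l ∈ H := by
  induction l with
  | nil => exact H.one_mem
  | cons b l ih => cases b; exacts [H.mul_mem hq ih, H.mul_mem hp ih]

theorem enc_word (p q : L32) (l : List Bool) :
    enc (word (· * ·) 1 p q l) = word BMat.mul BMat.one (enc p) (enc q) l := by
  induction l with
  | nil => exact enc_one
  | cons b l ih => cases b <;> simp [word, enc_mul, ih]

theorem mem_of_word {H : Subgroup L32} (i : Fin 3) (hS : S ∈ H) (hT : T i ∈ H) (z : L32)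
    (l : List Bool)
    (h : BMat.beq (enc z) (word BMat.mul BMat.one BMat.s (BMat.t i) l) = true) : z ∈ H := by
  have : z = word (· * ·) 1 S (T i) l := by
    apply enc_inj; rw [enc_word, enc_S, enc_T]; exact BMat.eq_of_beq h
  rw [this]; exact word_mem hS hT l

theorem top_of_T (i : Fin 3) (H : Subgroup L32) (hS : S ∈ H) (hT : T i ∈ H) : H = ⊤ := by
  fin_cases i
  · refine top_of_gens H hS
      (mem_of_word 0 hS hT R [true, false, true, true, true, true, false, true, false] ?_) ?_
    · rw [enc_R]; decide +kernel
    intro j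
    fin_cases j
    · exact hT
    · refine mem_of_word 0 hS hT (T 1)
        [true, true, true, false, true, true, true, true, false] ?_
      rw [enc_T]; decide +kernel
    · refine mem_of_word 0 hS hT (T 2)
        [false, true, true, false, true, false, true, false] ?_
      rw [enc_T]; decide +kernel
  · refine top_of_gens H hS
      (mem_of_word 1 hS hT R [false, true, false, true, true, true, false, true, true] ?_) ?_
    · rw [enc_R]; decide +kernel
    intro j
    fin_cases j
    · refine mem_of_word 1 hS hT (T 0)
        [false, true, true, true, false, true, true, true] ?_
      rw [enc_T]; decide +kernel
    · exact hT
    · refine mem_of_word 1 hS hT (T 2)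
        [false, false, true, false, true, true, false] ?_
      rw [enc_T]; decide +kernel
  · refine top_of_gens H hS
      (mem_of_word 2 hS hT R [true, false, true, false, false, true, true] ?_) ?_
    · rw [enc_R]; decide +kernel
    intro j
    fin_cases j
    · refine mem_of_word 2 hS hT (T 0)
        [true, true, false, true, false, true, true, true] ?_
      rw [enc_T]; decide +kernel
    · refine mem_of_word 2 hS hT (T 1)
        [false, false, false, true, true, false, false, true] ?_
      rw [enc_T]; decide +kernel
    · exact hT

/-- `S` together with any element outside its normalizer generates the group. -/
theorem top_of_not_isN (y : L32) (h : BMat.isN (enc y) = false) (H : Subgroup L32)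
    (hS : S ∈ H) (hy : y ∈ H) : H = ⊤ := by
  obtain ⟨i, m, n, e⟩ := cover_T y h
  refine top_of_T i H hS ?_
  have : T i = (S ^ m)⁻¹ * y * (S ^ n)⁻¹ := by rw [e]; group
  rw [this]
  exact H.mul_mem (H.mul_mem (H.inv_mem (H.pow_mem hS _)) hy) (H.inv_mem (H.pow_mem hS _))

/-- Representatives of the cosets of the normalizer of `S`. -/
def gg : ℕ → L32
  | 0 => 1
  | k + 1 => S ^ k * T 0

theorem enc_conj (j : ℕ) (hj : j < 8) (x : L32) :
    enc ((gg j)⁻¹ * x * gg j) = BMat.cj j (enc x) := by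
  cases j with
  | zero => simp [gg, BMat.cj]
  | succ k =>
    have h1 : (T 0)⁻¹ = T 0 := inv_eq_of_mul_eq_one_left T0_sq
    have h2 : (S ^ k)⁻¹ = S ^ (7 - k) := by
      apply inv_eq_of_mul_eq_one_left
      rw [← pow_add, Nat.sub_add_cancel (by omega), S_pow]
    have : (gg (k + 1))⁻¹ * x * gg (k + 1) = T 0 * (S ^ (7 - k) * (x * (S ^ k * T 0))) := by
      simp only [gg, mul_inv_rev, h1, h2, mul_assoc]
    rw [this]
    simp only [enc_mul, enc_pow, enc_T, BMat.cj]

def bad (x : L32) : Finset ℕ := (Finset.range 8).filter fun j => BMat.isN (BMat.cj j (enc x)) = true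

theorem bad_card (x : L32) (hx : x ≠ 1) : (bad x).card ≤ 2 := by
  have h0 := BMat.all_spec BMat.chk2_all (enc x)
  simp only [BMat.chk2, enc_det, cond_true, Bool.or_eq_true] at h0
  rcases h0 with h0 | h0
  · exact absurd (enc_inj ((BMat.eq_of_beq h0).trans enc_one.symm)) hx
  · have h1 := Nat.le_of_ble_eq_true h0
    rw [List.countP_eq_length_filter] at h1
    refine le_trans (le_of_eq ?_) h1
    simp only [bad, Finset.card_def, Finset.filter_val, Finset.range_val, Multiset.range,
      Multiset.filter_coe, Multiset.coe_card, Bool.decide_eq_true]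

theorem gen_of_not_bad (x : L32) (j : ℕ) (hj : j < 8) (h : j ∉ bad x) :
    Subgroup.closure {x, gg j * S * (gg j)⁻¹} = ⊤ := by
  set H := Subgroup.closure {x, gg j * S * (gg j)⁻¹} with hH
  have hn : BMat.isN (enc ((gg j)⁻¹ * x * gg j)) = false := by
    rw [enc_conj j hj]
    simpa [bad, hj] using h
  have hx : x ∈ H := Subgroup.subset_closure (by simp)
  have hs : gg j * S * (gg j)⁻¹ ∈ H := Subgroup.subset_closure (by simp)
  have key : H.comap (MulAut.conj (gg j)).toMonoidHom = ⊤ := by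
    refine top_of_not_isN _ hn _ ?_ ?_
    · simpa [Subgroup.mem_comap] using hs
    · simpa [Subgroup.mem_comap, mul_assoc] using hx
  rw [eq_top_iff]
  intro z _
  have hz : (gg j)⁻¹ * z * gg j ∈ H.comap (MulAut.conj (gg j)).toMonoidHom := by
    rw [key]; trivial
  simpa [Subgroup.mem_comap, mul_assoc] using hz

end Transfer

/-- The uniform spread of `L₃(2) = SL(3, 𝔽₂)` is at least three, with `s` of order 7:
for all nonidentity `x₁, x₂, x₃` there is `s` of order 7 generating the group with
each `x i`. -/
theorem stmt_17 :
    ∀ x₁ x₂ x₃ : L32, x₁ ≠ 1 → x₂ ≠ 1 → x₃ ≠ 1 →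
      ∃ s : L32, orderOf s = 7 ∧
        Subgroup.closure {x₁, s} = ⊤ ∧
        Subgroup.closure {x₂, s} = ⊤ ∧
        Subgroup.closure {x₃, s} = ⊤ := by
  intro x₁ x₂ x₃ h₁ h₂ h₃
  have hc : (bad x₁ ∪ bad x₂ ∪ bad x₃).card < (Finset.range 8).card := by
    have a := Finset.card_union_le (bad x₁ ∪ bad x₂) (bad x₃)
    have b := Finset.card_union_le (bad x₁) (bad x₂)
    have c₁ := bad_card x₁ h₁
    have c₂ := bad_card x₂ h₂
    have c₃ := bad_card x₃ h₃
    rw [Finset.card_range]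
    omega
  obtain ⟨j, hj, hn⟩ := Finset.exists_mem_notMem_of_card_lt_card hc
  simp only [Finset.mem_union, not_or] at hn
  rw [Finset.mem_range] at hj
  refine ⟨gg j * S * (gg j)⁻¹, ?_, gen_of_not_bad x₁ j hj hn.1.1, gen_of_not_bad x₂ j hj hn.1.2,
    gen_of_not_bad x₃ j hj hn.2⟩
  have : Fact (Nat.Prime 7) := ⟨by norm_num⟩
  apply orderOf_eq_prime
  · rw [conj_pow, S_pow]; simp
  · intro h
    apply S_ne
    simpa using h
end
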